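/- arXiv:2405.01294 — 13 statements merged into one kernel-verified Lean document; each statement's English description precedes it below -/
import Mathlib

section
/- Let δ be an ideal expansion of a commutative ring R and let A be a proper ideal of R. Then the following are equivalent: (i) A is a δ(0)-ideal of R; (ii) for every x ∈ R with x ∉ δ(0), A = (A : x), where (A : x) = {y ∈ R : x·y ∈ A}; (iii) for all ideals I and J of R, if I·J ⊆ A and J is not contained in δ(0), then I ⊆ A. -/
/-- An ideal expansion of a commutative ring `R`: a function `δ` on ideals with
`I ⊆ δ I` and monotone. -/
def IdealExpansion (R : Type*) [CommRing R] (δ : Ideal R → Ideal R) : Prop :=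
  (∀ I : Ideal R, I ≤ δ I) ∧ ∀ I J : Ideal R, I ≤ J → δ I ≤ δ J

/-- A proper ideal `A` is a `δ(0)`-ideal if `x * y ∈ A` and `y ∉ δ 0` imply `x ∈ A`. -/
def IsDeltaZeroIdeal {R : Type*} [CommRing R] (δ : Ideal R → Ideal R) (A : Ideal R) : Prop :=
  A ≠ ⊤ ∧ ∀ x y : R, x * y ∈ A → y ∉ δ 0 → x ∈ A

theorem stmt_0 {R : Type*} [CommRing R] (δ : Ideal R → Ideal R)
    (hδ : IdealExpansion R δ) (A : Ideal R) (hA : A ≠ ⊤) :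
    (IsDeltaZeroIdeal δ A ↔
      ∀ x : R, x ∉ δ 0 → ∀ y : R, y ∈ A ↔ x * y ∈ A) ∧
    ((∀ x : R, x ∉ δ 0 → ∀ y : R, y ∈ A ↔ x * y ∈ A) ↔
      ∀ I J : Ideal R, I * J ≤ A → ¬ J ≤ δ 0 → I ≤ A) := by
  refine ⟨⟨fun h x hx y => ⟨fun hy => A.mul_mem_left x hy, fun hxy => ?_⟩, fun h => ⟨hA, ?_⟩⟩,
    fun h I J hIJ hJ a ha => ?_, fun h x hx y => ⟨fun hy => A.mul_mem_left x hy, fun hxy => ?_⟩⟩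
  · exact h.2 y x (mul_comm x y ▸ hxy) hx
  · exact fun x y hxy hy => (h y hy x).2 (mul_comm x y ▸ hxy)
  · obtain ⟨b, hbJ, hb⟩ := SetLike.not_le_iff_exists.1 hJ
    exact (h b hb a).2 (mul_comm a b ▸ hIJ (Ideal.mul_mem_mul ha hbJ))
  · refine (Ideal.span_singleton_le_iff_mem A).1 (h (Ideal.span {y}) (Ideal.span {x}) ?_ ?_)
    · rwa [Ideal.span_singleton_mul_span_singleton, Ideal.span_singleton_le_iff_mem, mul_comm]
    · rwa [Ideal.span_singleton_le_iff_mem]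
end

section
/- Let δ be an ideal expansion of a commutative ring R, let I be an ideal of R that is not contained in δ(0), and let A and B be δ(0)-ideals of R. If I·A = I·B, then A = B. -/
theorem IsDeltaZeroIdeal.le_of_mul_le {R : Type*} [CommRing R] {δ : Ideal R → Ideal R}
    {I A B : Ideal R} (hB : IsDeltaZeroIdeal δ B) (hI : ¬ I ≤ δ 0) (h : I * A ≤ B) :
    A ≤ B := by
  obtain ⟨y, hyI, hy⟩ := SetLike.not_le_iff_exists.mp hI
  exact fun a ha => hB.2 a y (mul_comm y a ▸ h (Ideal.mul_mem_mul hyI ha)) hy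

theorem stmt_1 {R : Type*} [CommRing R] (δ : Ideal R → Ideal R)
    (hδ : IdealExpansion R δ) (I A B : Ideal R) (hI : ¬ I ≤ δ 0)
    (hA : IsDeltaZeroIdeal δ A) (hB : IsDeltaZeroIdeal δ B)
    (h : I * A = I * B) : A = B := by
  exact le_antisymm (hB.le_of_mul_le hI (h.trans_le Ideal.mul_le_right))
    (hA.le_of_mul_le hI (h.symm.trans_le Ideal.mul_le_right))
end

section
/- Let δ be an ideal expansion of a commutative ring R, and let I and A be ideals of R such that I is not contained in δ(0). If the product ideal I·A is a δ(0)-ideal of R, then I·A = A. -/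
theorem stmt_2 {R : Type*} [CommRing R] (δ : Ideal R → Ideal R)
    (hδ : IdealExpansion R δ) (I A : Ideal R) (hI : ¬ I ≤ δ 0)
    (h : IsDeltaZeroIdeal δ (I * A)) : I * A = A := by
  obtain ⟨y, hyI, hy⟩ := SetLike.not_le_iff_exists.mp hI
  refine le_antisymm Ideal.mul_le_right fun x hx => h.2 x y ?_ hy
  rw [mul_comm x y]
  exact Ideal.mul_mem_mul hyI hx
end

section
/- Let δ be an ideal expansion of a commutative ring R, let A be a δ(0)-ideal of R, and let S be a nonempty subset of R that is not contained in A. Then the ideal (A : S) = {x ∈ R : x·s ∈ A for every s ∈ S} is a δ(0)-ideal of R. -/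
theorem stmt_3 {R : Type*} [CommRing R] (δ : Ideal R → Ideal R)
    (hδ : IdealExpansion R δ) (A : Ideal R) (hA : IsDeltaZeroIdeal δ A)
    (S : Set R) (hS : S.Nonempty) (hSA : ¬ S ⊆ (A : Set R)) :
    IsDeltaZeroIdeal δ (A.colon (Ideal.span S)) := by
  refine ⟨fun htop => hSA fun s hs => ?_, fun x y hxy hy => ?_⟩
  · have h1 : (1 : R) ∈ A.colon (Ideal.span S) := htop ▸ Submodule.mem_top
    simpa using Submodule.mem_colon.mp h1 s (Ideal.subset_span hs)
  · refine Submodule.mem_colon.mpr fun s hs => hA.2 _ y ?_ hy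
    have h := Submodule.mem_colon.mp hxy s hs
    rwa [smul_eq_mul, mul_right_comm] at h
end

section
/- Let δ be an ideal expansion of a commutative ring R such that δ(0) is a maximal ideal of R, and let A be a J-ideal of R. Then A is a δ(0)-ideal of R. -/
/-- A proper ideal `A` is a `J`-ideal if `x * y ∈ A` and `x ∉ J(R)` imply `y ∈ A`,
where `J(R)` is the Jacobson radical of `R`. -/
def IsJIdeal {R : Type*} [CommRing R] (A : Ideal R) : Prop :=
  A ≠ ⊤ ∧ ∀ x y : R, x * y ∈ A → x ∉ Ideal.jacobson (⊥ : Ideal R) → y ∈ A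

theorem stmt_5 {R : Type*} [CommRing R] (δ : Ideal R → Ideal R)
    (hδ : IdealExpansion R δ) (hmax : (δ 0).IsMaximal)
    (A : Ideal R) (hA : IsJIdeal A) : IsDeltaZeroIdeal δ A := by
  refine ⟨hA.1, fun x y hxy hy => hA.2 y x (mul_comm x y ▸ hxy) fun hyJ => hy ?_⟩
  exact Ideal.mem_sInf.mp hyJ ⟨bot_le, hmax⟩
end

section
/- Let δ be an ideal expansion of a commutative ring R. Every δ(0)-ideal A of R is contained in δ(0). -/
theorem stmt_6 {R : Type*} [CommRing R] (δ : Ideal R → Ideal R)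
    (hδ : IdealExpansion R δ) (A : Ideal R) (hA : IsDeltaZeroIdeal δ A) :
    A ≤ δ 0 := by
  intro y hy
  by_contra hyδ
  exact hA.1 ((Ideal.eq_top_iff_one A).2 (hA.2 1 y (by rwa [one_mul]) hyδ))
end

section
/- Let δ be an ideal expansion of a commutative ring R and let A be a prime ideal of R with δ(A) = A. Then A is a δ(0)-ideal of R if and only if A = δ(0). -/
theorem stmt_8 {R : Type*} [CommRing R] (δ : Ideal R → Ideal R)
    (hδ : IdealExpansion R δ) (A : Ideal R) (hp : A.IsPrime) (hfix : δ A = A) :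
    IsDeltaZeroIdeal δ A ↔ A = δ 0 := by
  constructor
  · rintro ⟨hne, h⟩
    apply le_antisymm
    · intro y hy
      by_contra hy0
      exact hne ((Ideal.eq_top_iff_one A).2 (h 1 y (by rwa [one_mul]) hy0))
    · exact (hδ.2 0 A bot_le).trans_eq hfix
  · intro hA
    refine ⟨hp.ne_top, fun x y hxy hy => ?_⟩
    rw [← hA] at hy
    exact (hp.mem_or_mem hxy).resolve_right hy
end

section
/- Let δ be an ideal expansion of a commutative ring R. If the zero ideal of R is a δ(0)-ideal and rad(δ(0)) = δ(0), then the nilradical rad(0) of R is a δ(0)-ideal of R. -/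
theorem stmt_12 {R : Type*} [CommRing R] (δ : Ideal R → Ideal R)
    (hδ : IdealExpansion R δ) (h0 : IsDeltaZeroIdeal δ (0 : Ideal R))
    (hrad : (δ 0).radical = δ 0) :
    IsDeltaZeroIdeal δ (Ideal.radical (0 : Ideal R)) := by
  refine ⟨fun h => h0.1 (Ideal.radical_eq_top.1 h), fun x y ⟨n, hn⟩ hy => ⟨n, ?_⟩⟩
  rw [mul_pow] at hn
  refine h0.2 _ _ hn fun hyn => hy ?_
  rw [← hrad]
  exact ⟨n, hyn⟩
end

section
/- Let δ be an ideal expansion of a commutative ring R and let A be a proper ideal of R. Then: (i) if A is a δ(0)-ideal of R, then A is δ-primary; (ii) if moreover δ(δ(0)) ⊆ δ(0), then A is a δ(0)-ideal of R if and only if A is δ-primary and A ⊆ δ(0). -/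
/-- A proper ideal `A` is `δ`-primary if `x * y ∈ A` implies `x ∈ A` or `y ∈ δ A`. -/
def IsDeltaPrimary {R : Type*} [CommRing R] (δ : Ideal R → Ideal R) (A : Ideal R) : Prop :=
  A ≠ ⊤ ∧ ∀ x y : R, x * y ∈ A → x ∈ A ∨ y ∈ δ A

theorem IsDeltaZeroIdeal.isDeltaPrimary {R : Type*} [CommRing R] {δ : Ideal R → Ideal R}
    (hδ : IdealExpansion R δ) {A : Ideal R} (h : IsDeltaZeroIdeal δ A) : IsDeltaPrimary δ A := by
  refine ⟨h.1, fun x y hxy => or_iff_not_imp_right.mpr fun hy => h.2 x y hxy fun hy0 => hy ?_⟩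
  exact hδ.2 0 A bot_le hy0

theorem IsDeltaZeroIdeal.le {R : Type*} [CommRing R] {δ : Ideal R → Ideal R}
    {A : Ideal R} (h : IsDeltaZeroIdeal δ A) : A ≤ δ 0 := by
  intro a ha
  by_contra ha0
  exact h.1 ((Ideal.eq_top_iff_one A).mpr (h.2 1 a (by rwa [one_mul]) ha0))

theorem IsDeltaPrimary.isDeltaZeroIdeal {R : Type*} [CommRing R] {δ : Ideal R → Ideal R}
    (hδ : IdealExpansion R δ) (hδ0 : δ (δ 0) ≤ δ 0) {A : Ideal R} (h : IsDeltaPrimary δ A)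
    (hA : A ≤ δ 0) : IsDeltaZeroIdeal δ A :=
  ⟨h.1, fun x y hxy hy => (h.2 x y hxy).resolve_right fun hyA => hy (hδ0 (hδ.2 A _ hA hyA))⟩

theorem stmt_13 {R : Type*} [CommRing R] (δ : Ideal R → Ideal R)
    (hδ : IdealExpansion R δ) (A : Ideal R) (hA : A ≠ ⊤) :
    (IsDeltaZeroIdeal δ A → IsDeltaPrimary δ A) ∧
    (δ (δ 0) ≤ δ 0 →
      (IsDeltaZeroIdeal δ A ↔ IsDeltaPrimary δ A ∧ A ≤ δ 0)) :=
  ⟨fun h => h.isDeltaPrimary hδ, fun hδ0 =>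
    ⟨fun h => ⟨h.isDeltaPrimary hδ, h.le⟩, fun h => h.1.isDeltaZeroIdeal hδ hδ0 h.2⟩⟩
end

section
/- Let δ be an ideal expansion of a commutative ring R. If R has at least one δ(0)-ideal, then the set of δ(0)-ideals of R, partially ordered by inclusion, has a maximal element. Moreover, if in addition δ(A) = A for every δ(0)-ideal A that is maximal (with respect to inclusion) among the δ(0)-ideals of R, then δ(0) is a prime ideal of R. -/
namespace IsDeltaZeroIdeal

variable {R : Type*} [CommRing R] {δ : Ideal R → Ideal R}

theorem le_delta_zero {A : Ideal R} (hA : IsDeltaZeroIdeal δ A) : A ≤ δ 0 := by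
  intro a ha
  by_contra h
  exact hA.1 ((Ideal.eq_top_iff_one A).2 (hA.2 1 a (by rwa [one_mul]) h))

theorem sSup_of_isChain {c : Set (Ideal R)} (hc : IsChain (· ≤ ·) c) (hne : c.Nonempty)
    (h : ∀ A ∈ c, IsDeltaZeroIdeal δ A) : IsDeltaZeroIdeal δ (sSup c) := by
  have mem_iff (x : R) : x ∈ sSup c ↔ ∃ A ∈ c, x ∈ A :=
    Submodule.mem_sSup_of_directed hne hc.directedOn
  refine ⟨fun htop => ?_, fun x y hxy hy => ?_⟩
  · obtain ⟨A, hA, h1⟩ := (mem_iff 1).1 (htop ▸ Submodule.mem_top)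
    exact (h A hA).1 ((Ideal.eq_top_iff_one A).2 h1)
  · obtain ⟨A, hA, hxyA⟩ := (mem_iff _).1 hxy
    exact (mem_iff x).2 ⟨A, hA, (h A hA).2 x y hxyA hy⟩

theorem exists_maximal (hex : ∃ A : Ideal R, IsDeltaZeroIdeal δ A) :
    ∃ M : Ideal R, Maximal (IsDeltaZeroIdeal δ) M := by
  obtain ⟨A, hA⟩ := hex
  obtain ⟨M, -, hM⟩ := zorn_le_nonempty₀ {B | IsDeltaZeroIdeal δ B}
    (fun c hcs hc B hB => ⟨sSup c, sSup_of_isChain hc ⟨B, hB⟩ fun _ h => hcs h,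
      fun _ h => le_sSup h⟩) A hA
  exact ⟨M, hM⟩

theorem isPrime_of_delta_eq_self (hδ : IdealExpansion R δ) {A : Ideal R}
    (hA : IsDeltaZeroIdeal δ A) (h : δ A = A) : (δ 0).IsPrime := by
  have h0 : δ 0 = A := le_antisymm ((hδ.2 0 A bot_le).trans_eq h) hA.le_delta_zero
  refine ⟨h0 ▸ hA.1, fun {x y} hxy => or_iff_not_imp_right.2 fun hy => ?_⟩
  rw [h0] at hxy ⊢
  exact hA.2 x y hxy hy

end IsDeltaZeroIdeal

theorem stmt_14 {R : Type*} [CommRing R] (δ : Ideal R → Ideal R)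
    (hδ : IdealExpansion R δ) (hex : ∃ A : Ideal R, IsDeltaZeroIdeal δ A) :
    (∃ M : Ideal R, IsDeltaZeroIdeal δ M ∧
        ∀ B : Ideal R, IsDeltaZeroIdeal δ B → ¬ M < B) ∧
    ((∀ A : Ideal R, IsDeltaZeroIdeal δ A →
        (∀ B : Ideal R, IsDeltaZeroIdeal δ B → ¬ A < B) → δ A = A) →
      (δ 0).IsPrime) := by
  obtain ⟨M, hM⟩ := IsDeltaZeroIdeal.exists_maximal hex
  have hmax : ∀ B : Ideal R, IsDeltaZeroIdeal δ B → ¬ M < B := fun _ hB => hM.not_gt hB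
  exact ⟨⟨M, hM.prop, hmax⟩,
    fun h => hM.prop.isPrime_of_delta_eq_self hδ (h M hM.prop hmax)⟩
end

section
/- Let δ be an ideal expansion of a commutative ring R, let A be a δ(0)-ideal of R, and let S be a multiplicatively closed subset of R containing 1 with S ∩ A = ∅. Let A^e and δ(0)^e denote the extensions (images under Ideal.map) of A and δ(0) in the localization S⁻¹R along the canonical map R → S⁻¹R. Then for all α, β ∈ S⁻¹R, if α·β ∈ A^e and β ∉ δ(0)^e, then α ∈ A^e. -/
theorem stmt_15 {R : Type*} [CommRing R] (δ : Ideal R → Ideal R)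
    (hδ : IdealExpansion R δ) (A : Ideal R) (hA : IsDeltaZeroIdeal δ A)
    (S : Submonoid R) (hdisj : (S : Set R) ∩ (A : Set R) = ∅) :
    ∀ α β : Localization S,
      α * β ∈ A.map (algebraMap R (Localization S)) →
      β ∉ (δ 0).map (algebraMap R (Localization S)) →
      α ∈ A.map (algebraMap R (Localization S)) := by
  intro α β hαβ hβ
  obtain ⟨a, s, rfl⟩ := IsLocalization.exists_mk'_eq S α
  obtain ⟨b, t, rfl⟩ := IsLocalization.exists_mk'_eq S β
  rw [← IsLocalization.mk'_mul, IsLocalization.mk'_mem_map_algebraMap_iff] at hαβ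
  rw [IsLocalization.mk'_mem_map_algebraMap_iff] at hβ ⊢
  obtain ⟨u, hu, huab⟩ := hαβ
  refine ⟨u, hu, hA.2 (u * a) b (by rwa [mul_assoc]) fun hb => hβ ⟨1, S.one_mem, ?_⟩⟩
  rwa [one_mul]
end

section
/- Let δ be an ideal expansion of a commutative ring R with δ(0) ≠ R, let A be an ideal of R, and let S be a δ(0)-multiplicative subset of R with S ∩ A = ∅. Then there exists a δ(0)-ideal B of R such that A ⊆ B and B ∩ S = ∅. -/
/-- A subset `S` of `R` is a `δ(0)`-multiplicative subset if `R ∖ δ(0) ⊆ S` and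
`x * y ∈ S` for all `x ∈ S` and `y ∈ R ∖ δ(0)`. -/
def IsDeltaZeroMultSubset {R : Type*} [CommRing R] (δ : Ideal R → Ideal R) (S : Set R) : Prop :=
  ((δ 0 : Ideal R) : Set R)ᶜ ⊆ S ∧ ∀ x ∈ S, ∀ y : R, y ∉ δ 0 → x * y ∈ S

/-- An ideal disjoint from a set `S` is contained in an ideal maximal among those disjoint
from `S`. -/
theorem Ideal.exists_le_maximal_disjoint_set {R : Type*} [CommRing R] {A : Ideal R} {S : Set R}
    (h : Disjoint (A : Set R) S) :
    ∃ B : Ideal R, A ≤ B ∧ Maximal (fun I : Ideal R => Disjoint (I : Set R) S) B := by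
  refine zorn_le_nonempty₀ {I : Ideal R | Disjoint (I : Set R) S} ?_ A h
  intro c hc hchain I hI
  refine ⟨sSup c, Set.disjoint_left.2 fun x hx hxS => ?_, fun _ => le_sSup⟩
  obtain ⟨J, hJ, hxJ⟩ := (Submodule.mem_sSup_of_directed ⟨I, hI⟩ hchain.directedOn).1 hx
  exact Set.disjoint_left.1 (hc hJ) hxJ hxS

theorem stmt_17 {R : Type*} [CommRing R] (δ : Ideal R → Ideal R)
    (hδ : IdealExpansion R δ) (hprop : δ 0 ≠ ⊤) (A : Ideal R) (S : Set R)
    (hS : IsDeltaZeroMultSubset δ S) (hdisj : S ∩ (A : Set R) = ∅) :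
    ∃ B : Ideal R, IsDeltaZeroIdeal δ B ∧ A ≤ B ∧ (B : Set R) ∩ S = ∅ := by
  obtain ⟨B, hAB, hB⟩ := Ideal.exists_le_maximal_disjoint_set
    (Set.disjoint_iff_inter_eq_empty.2 hdisj).symm
  have hBS := Set.disjoint_left.1 hB.prop
  refine ⟨B, ⟨fun hTop => ?_, fun x y hxy hy => ?_⟩, hAB,
    Set.disjoint_iff_inter_eq_empty.1 hB.prop⟩
  · exact hBS (hTop ▸ Submodule.mem_top) (hS.1 ((Ideal.ne_top_iff_one _).1 hprop))
  · have hcolon : Disjoint ((B.colon {y} : Ideal R) : Set R) S :=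
      Set.disjoint_left.2 fun s hs hsS =>
        hBS (Submodule.mem_colon_singleton.1 hs) (hS.2 s hsS y hy)
    exact hB.le_of_ge hcolon (fun b hb => Submodule.mem_colon_singleton.2 (B.mul_mem_right y hb))
      (Submodule.mem_colon_singleton.2 hxy)
end

section
/- Let R₁ and R₂ be commutative rings with ideal expansions δ and γ respectively, and let ψ : R₁ → R₂ be a ring homomorphism such that δ(ψ⁻¹(J)) = ψ⁻¹(γ(J)) for every ideal J of R₂ (a δγ-homomorphism). Then: (i) if ψ is injective and A₂ is a γ(0)-ideal of R₂, then ψ⁻¹(A₂) is a δ(0)-ideal of R₁; (ii) if ψ is surjective, A₁ is a δ(0)-ideal of R₁ and ker ψ ⊆ A₁, then the image ψ(A₁) is a γ(0)-ideal of R₂. -/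
theorem stmt_19 {R₁ : Type*} {R₂ : Type*} [CommRing R₁] [CommRing R₂]
    (δ : Ideal R₁ → Ideal R₁) (γ : Ideal R₂ → Ideal R₂)
    (hδ : IdealExpansion R₁ δ) (hγ : IdealExpansion R₂ γ)
    (ψ : R₁ →+* R₂) (hψ : ∀ J : Ideal R₂, δ (J.comap ψ) = (γ J).comap ψ) :
    (Function.Injective ψ → ∀ A₂ : Ideal R₂, IsDeltaZeroIdeal γ A₂ →
      IsDeltaZeroIdeal δ (A₂.comap ψ)) ∧
    (Function.Surjective ψ → ∀ A₁ : Ideal R₁, IsDeltaZeroIdeal δ A₁ →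
      RingHom.ker ψ ≤ A₁ → IsDeltaZeroIdeal γ (A₁.map ψ)) := by
  refine ⟨fun hinj A₂ hA₂ => ⟨Ideal.comap_ne_top ψ hA₂.1, fun x y hxy hy => ?_⟩,
    fun hsurj A₁ hA₁ hker => ?_⟩
  · have hbot : (0 : Ideal R₂).comap ψ = 0 := (RingHom.injective_iff_ker_eq_bot ψ).mp hinj
    rw [Ideal.mem_comap, map_mul] at hxy
    rw [← hbot, hψ] at hy
    exact hA₂.2 _ _ hxy hy
  · have hcomap : (A₁.map ψ).comap ψ = A₁ := by
      rw [Ideal.comap_map_of_surjective' ψ hsurj, sup_eq_left.mpr hker]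
    refine ⟨fun htop => hA₁.1 (by rw [← hcomap, htop, Ideal.comap_top]), fun x y hxy hy => ?_⟩
    obtain ⟨a, rfl⟩ := hsurj x
    obtain ⟨b, rfl⟩ := hsurj y
    refine Ideal.mem_map_of_mem ψ (hA₁.2 a b ?_ fun hb => hy ?_)
    · rwa [← hcomap, Ideal.mem_comap, map_mul]
    · rw [← Ideal.mem_comap, ← hψ]
      exact hδ.2 _ _ bot_le hb
end
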